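/- Let (Y,S) be a topological dynamical system which is minimal, weakly mixing, not connected, and such that every subcontinuum of Y is unicoherent. Let n > 0 be an integer and let (X,T) be an extension of (Y,S) with factor map π: X → Y satisfying #π^{-1}(y) = n for every y ∈ Y. Then for every minimal set M ⊆ X of T, the restricted system (M, T|_M) is Li-Yorke sensitive. -/

import Mathlib

open Filter Topology Metric Set

/-- The liminf of the distance between the orbits of `x` and `y` under `T`. -/
noncomputable def orbLiminf {X : Type*} [MetricSpace X] (T : X → X) (x y : X) : ℝ :=
  Filter.atTop.liminf fun n : ℕ => dist (T^[n] x) (T^[n] y)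

/-- The limsup of the distance between the orbits of `x` and `y` under `T`. -/
noncomputable def orbLimsup {X : Type*} [MetricSpace X] (T : X → X) (x y : X) : ℝ :=
  Filter.atTop.limsup fun n : ℕ => dist (T^[n] x) (T^[n] y)

/-- `(x,y)` is an `ε`-Li-Yorke pair: proximal but not `ε`-asymptotic. -/
def LiYorkePairEps {X : Type*} [MetricSpace X] (T : X → X) (ε : ℝ) (x y : X) : Prop :=
  orbLiminf T x y = 0 ∧ orbLimsup T x y > ε

/-- `T` is Li-Yorke sensitive with sensitivity constant `ε`: every point is a limit of
points forming with it an `ε`-Li-Yorke pair. -/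
def LYSeps {X : Type*} [MetricSpace X] (T : X → X) (ε : ℝ) : Prop :=
  ∀ x : X, x ∈ closure {y | LiYorkePairEps T ε x y}

/-- `T` is Li-Yorke sensitive. -/
def LYS {X : Type*} [MetricSpace X] (T : X → X) : Prop :=
  ∃ ε > 0, LYSeps T ε

/-- Topological transitivity. -/
def TopTransitive {X : Type*} [TopologicalSpace X] (T : X → X) : Prop :=
  ∀ U V : Set X, IsOpen U → IsOpen V → U.Nonempty → V.Nonempty →
    ∃ n : ℕ, 0 < n ∧ (U ∩ T^[n] ⁻¹' V).Nonempty

/-- Weak mixing: the product system is transitive. -/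
def WeaklyMixing {X : Type*} [TopologicalSpace X] (T : X → X) : Prop :=
  TopTransitive fun p : X × X => (T p.1, T p.2)

/-- Minimality: every forward orbit is dense. -/
def MinimalSystem {X : Type*} [TopologicalSpace X] (T : X → X) : Prop :=
  ∀ x : X, Dense (Set.range fun n : ℕ => T^[n] x)

/-- `M` is a minimal set for `T`: nonempty, closed, invariant, and every orbit of a point
of `M` is dense in `M`. -/
def IsMinimalSubset {X : Type*} [TopologicalSpace X] (T : X → X) (M : Set X) : Prop :=
  M.Nonempty ∧ IsClosed M ∧ Set.MapsTo T M M ∧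
    ∀ x ∈ M, ∀ y ∈ M, y ∈ closure (Set.range fun n : ℕ => T^[n] x)

/-- A set `D` is `ε`-scrambled for `T`. -/
def ScrambledSet {X : Type*} [MetricSpace X] (T : X → X) (ε : ℝ) (D : Set X) : Prop :=
  ∀ x ∈ D, ∀ y ∈ D, x ≠ y → LiYorkePairEps T ε x y

/-- A topological space is unicoherent if for any two subcontinua (nonempty compact
connected subsets) covering the space, their intersection is connected. -/
def UnicoherentSpace (Z : Type*) [TopologicalSpace Z] : Prop :=
  ∀ A B : Set Z, IsCompact A → IsConnected A → IsCompact B → IsConnected B →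
    A ∪ B = Set.univ → IsConnected (A ∩ B)

/-- A subset `Z` is unicoherent if for any two subcontinua `A`, `B` with `A ∪ B = Z`,
the intersection `A ∩ B` is connected. -/
def UnicoherentSet {Y : Type*} [TopologicalSpace Y] (Z : Set Y) : Prop :=
  ∀ A B : Set Y, IsCompact A → IsConnected A → IsCompact B → IsConnected B →
    A ∪ B = Z → IsConnected (A ∩ B)

section Dynamics

theorem semiconj_iterate {X Y : Type*} {T : X → X} {S : Y → Y} {π : X → Y}
    (h : ∀ x, π (T x) = S (π x))
    (n : ℕ) (x : X) : π (T^[n] x) = S^[n] (π x) :=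
  (Function.Semiconj.iterate_right (f := π) h n) x

variable {X Y : Type*} [TopologicalSpace X] [TopologicalSpace Y]

theorem MinimalSystem.surjective [CompactSpace X] [T2Space X] {T : X → X} (hT : MinimalSystem T)
    (hc : Continuous T) : Function.Surjective T := by
  intro x
  have hcl : IsClosed (range T) := (isCompact_range hc).isClosed
  have hsub : (range fun n : ℕ => T^[n] (T x)) ⊆ range T := by
    rintro _ ⟨n, rfl⟩
    exact ⟨T^[n] x, (Function.iterate_succ_apply' T n x).symm.trans
      (Function.iterate_succ_apply T n x)⟩
  exact (hcl.closure_subset_iff.2 hsub) (hT (T x) x)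

/-- Bounded return times: every orbit visits a given open set within a uniform time. -/
theorem MinimalSystem.exists_visit_bound [CompactSpace X] {T : X → X} (hT : MinimalSystem T)
    (hc : Continuous T)
    {A : Set X} (hA : IsOpen A) (hAn : A.Nonempty) : ∃ L : ℕ, ∀ x, ∃ j < L, T^[j] x ∈ A := by
  obtain ⟨t, ht⟩ := isCompact_univ.elim_finite_subcover (fun n : ℕ => T^[n] ⁻¹' A)
    (fun n => hA.preimage (hc.iterate n)) (by
      intro x _
      obtain ⟨_, ⟨n, rfl⟩, hz⟩ := (hT x).exists_mem_open hA hAn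
      exact mem_iUnion.2 ⟨n, hz⟩)
  refine ⟨t.sup id + 1, fun x => ?_⟩
  obtain ⟨n, hn, hx⟩ := mem_iUnion₂.1 (ht (mem_univ x))
  exact ⟨n, Nat.lt_succ_of_le (Finset.le_sup (f := id) hn), hx⟩

/-- A minimal map is irreducible: no proper closed set is mapped onto the whole space. -/
theorem MinimalSystem.eq_univ_of_image_eq_univ [CompactSpace X] [T2Space X] {T : X → X}
    (hT : MinimalSystem T)
    (hc : Continuous T) {A : Set X} (hA : IsClosed A) (hAT : T '' A = univ) : A = univ := by
  rcases isEmpty_or_nonempty X with hX | ⟨⟨x₀⟩⟩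
  · exact Subsingleton.elim _ _
  have hpre : ∀ x, ∃ a ∈ A, T a = x := fun x => by
    have : x ∈ T '' A := hAT ▸ mem_univ x
    exact this
  choose g hgA hg using hpre
  have hback : ∀ n k, T^[n] (g^[n + k + 1] x₀) ∈ A := by
    intro n
    induction n with
    | zero => intro k; simpa [Function.iterate_succ_apply'] using hgA (g^[k] x₀)
    | succ n ih =>
      intro k
      rw [Function.iterate_succ_apply, show n + 1 + k + 1 = (n + k + 1) + 1 by ring,
        Function.iterate_succ_apply' g, hg]
      exact ih k
  obtain ⟨z, -, hz⟩ := isCompact_univ.exists_mapClusterPt (f := atTop)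
    (u := fun n : ℕ => g^[n] x₀) (by simp)
  have hzA : ∀ n, T^[n] z ∈ A := by
    intro n
    have h1 : MapClusterPt (T^[n] z) atTop (T^[n] ∘ fun k : ℕ => g^[k] x₀) :=
      hz.continuousAt_comp (hc.iterate n).continuousAt
    refine hA.mem_of_mapClusterPt h1 ?_
    filter_upwards [eventually_ge_atTop (n + 1)] with k hk
    obtain ⟨l, rfl⟩ := Nat.exists_eq_add_of_le hk
    have := hback n l
    rwa [show n + l + 1 = n + 1 + l by ring] at this
  exact eq_univ_of_univ_subset fun x _ =>
    (hA.closure_subset_iff.2 (by rintro _ ⟨n, rfl⟩; exact hzA n)) (hT z x)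

theorem MinimalSystem.exists_preimage_iterate_subset [CompactSpace X] [T2Space X] {T : X → X}
    (hT : MinimalSystem T) (hc : Continuous T) (n : ℕ) {U : Set X} (hU : IsOpen U)
    (hUn : U.Nonempty) : ∃ V, IsOpen V ∧ V.Nonempty ∧ T^[n] ⁻¹' V ⊆ U := by
  induction n generalizing U with
  | zero => exact ⟨U, hU, hUn, subset_rfl⟩
  | succ n ih =>
    obtain ⟨V, hV, hVn, hVU⟩ : ∃ V, IsOpen V ∧ V.Nonempty ∧ T ⁻¹' V ⊆ U := by
      refine ⟨(T '' Uᶜ)ᶜ, (hU.isClosed_compl.isCompact.image hc).isClosed.isOpen_compl, ?_, ?_⟩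
      · rw [nonempty_compl]
        intro h
        have := hT.eq_univ_of_image_eq_univ hc hU.isClosed_compl h
        exact hUn.ne_empty (compl_univ_iff.1 this)
      · intro x hx
        by_contra hxU
        exact hx ⟨x, hxU, rfl⟩
    obtain ⟨W, hW, hWn, hWV⟩ := ih hV hVn
    refine ⟨W, hW, hWn, fun x hx => hVU (hWV ?_)⟩
    rwa [mem_preimage, ← Function.iterate_succ_apply]

/-- Factor maps onto minimal systems are semi-open. -/
theorem MinimalSystem.interior_image_nonempty [CompactSpace X] [CompactSpace Y] [T2Space X]
    [T2Space Y] {T : X → X} {S : Y → Y}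
    {π : X → Y} (hT : MinimalSystem T) (hTc : Continuous T) (hS : MinimalSystem S)
    (hSc : Continuous S) (hπ : Continuous π) (hπs : Function.Surjective π)
    (hfac : ∀ x, π (T x) = S (π x)) {U : Set X} (hU : IsOpen U) (hUn : U.Nonempty) :
    (interior (π '' U)).Nonempty := by
  obtain ⟨x₀, hx₀⟩ := hUn
  obtain ⟨K, hK, hKc, hKU⟩ := exists_mem_nhds_isClosed_subset (hU.mem_nhds hx₀)
  obtain ⟨L, hL⟩ := hT.exists_visit_bound hTc isOpen_interior ⟨x₀, mem_interior_iff_mem_nhds.2 hK⟩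
  have hKπ : IsClosed (π '' K) := (hKc.isCompact.image hπ).isClosed
  have : Nonempty Y := ⟨π x₀⟩
  obtain ⟨j, y, hy⟩ := nonempty_interior_of_iUnion_of_closed
    (f := fun j : Fin L => S^[j] ⁻¹' (π '' K)) (fun j => hKπ.preimage (hSc.iterate j)) (by
      refine eq_univ_of_forall fun y => ?_
      obtain ⟨x, rfl⟩ := hπs y
      obtain ⟨j, hj, hx⟩ := hL x
      exact mem_iUnion.2 ⟨⟨j, hj⟩, T^[j] x, interior_subset hx, semiconj_iterate hfac j x⟩)
  obtain ⟨V, hV, hVn, hVs⟩ := hS.exists_preimage_iterate_subset hSc j isOpen_interior ⟨y, hy⟩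
  refine hVn.mono (interior_maximal ?_ hV)
  intro v hv
  obtain ⟨w, rfl⟩ := (hS.surjective hSc).iterate j v
  have hw := interior_subset (hVs hv)
  exact image_mono hKU hw

theorem MinimalSystem.interior_image_iterate_nonempty [CompactSpace X] [T2Space X] {T : X → X}
    (hT : MinimalSystem T) (hTc : Continuous T) (n : ℕ) {U : Set X} (hU : IsOpen U)
    (hUn : U.Nonempty) : (interior (T^[n] '' U)).Nonempty :=
  hT.interior_image_nonempty hTc hT hTc (hTc.iterate n) ((hT.surjective hTc).iterate n)
    (fun x => (Function.Commute.iterate_left (Function.Commute.refl T) n) x) hU hUn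

/-- Weak mixing, phrased with open boxes and allowing the time `0`. -/
def BoxMixing (S : Y → Y) : Prop :=
  ∀ U₁ V₁ U₂ V₂ : Set Y, IsOpen U₁ → IsOpen V₁ → IsOpen U₂ → IsOpen V₂ →
    U₁.Nonempty → V₁.Nonempty → U₂.Nonempty → V₂.Nonempty →
    ∃ n : ℕ, (U₁ ∩ S^[n] ⁻¹' V₁).Nonempty ∧ (U₂ ∩ S^[n] ⁻¹' V₂).Nonempty

theorem WeaklyMixing.boxMixing {S : Y → Y} (hS : WeaklyMixing S) : BoxMixing S := by
  intro U₁ V₁ U₂ V₂ hU₁ hV₁ hU₂ hV₂ nU₁ nV₁ nU₂ nV₂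
  obtain ⟨n, -, p, hp, hq⟩ := hS (U₁ ×ˢ U₂) (V₁ ×ˢ V₂) (hU₁.prod hU₂) (hV₁.prod hV₂)
    (nU₁.prod nU₂) (nV₁.prod nV₂)
  have : (fun p : Y × Y => (S p.1, S p.2))^[n] p = (S^[n] p.1, S^[n] p.2) := by
    change (Prod.map S S)^[n] p = _
    rw [Prod.map_iterate]; rfl
  rw [mem_preimage, this] at hq
  exact ⟨n, ⟨p.1, hp.1, hq.1⟩, ⟨p.2, hp.2, hq.2⟩⟩

theorem BoxMixing.exists_subset_inter {S : Y → Y} (hS : BoxMixing S) (hSc : Continuous S)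
    {U₁ V₁ U₂ V₂ : Set Y} (hU₁ : IsOpen U₁) (hV₁ : IsOpen V₁) (hU₂ : IsOpen U₂)
    (hV₂ : IsOpen V₂) (nU₁ : U₁.Nonempty) (nV₁ : V₁.Nonempty) (nU₂ : U₂.Nonempty)
    (nV₂ : V₂.Nonempty) :
    ∃ U V : Set Y, IsOpen U ∧ IsOpen V ∧ U.Nonempty ∧ V.Nonempty ∧
      ∀ n : ℕ, (U ∩ S^[n] ⁻¹' V).Nonempty →
        (U₁ ∩ S^[n] ⁻¹' V₁).Nonempty ∧ (U₂ ∩ S^[n] ⁻¹' V₂).Nonempty := by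
  obtain ⟨k, hk₁, hk₂⟩ := hS U₁ U₂ V₁ V₂ hU₁ hU₂ hV₁ hV₂ nU₁ nU₂ nV₁ nV₂
  refine ⟨_, _, hU₁.inter (hU₂.preimage (hSc.iterate k)),
    hV₁.inter (hV₂.preimage (hSc.iterate k)), hk₁, hk₂, ?_⟩
  rintro n ⟨u, ⟨hu₁, hu₂⟩, hv₁, hv₂⟩
  refine ⟨⟨u, hu₁, hv₁⟩, ⟨S^[k] u, hu₂, ?_⟩⟩
  rw [mem_preimage, ← Function.iterate_add_apply, Nat.add_comm, Function.iterate_add_apply]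
  exact hv₂

/-- In a weakly mixing system the hitting times between open sets contain long intervals. -/
theorem BoxMixing.exists_interval {S : Y → Y} (hS : BoxMixing S) (hSc : Continuous S)
    (hSs : Function.Surjective S) {U V : Set Y} (hU : IsOpen U) (hV : IsOpen V)
    (nU : U.Nonempty) (nV : V.Nonempty) (m L : ℕ) :
    ∃ a ≥ m, ∀ j < L, (U ∩ S^[a + j] ⁻¹' V).Nonempty := by
  have key : ∀ L : ℕ, ∃ U' V' : Set Y, IsOpen U' ∧ IsOpen V' ∧ U'.Nonempty ∧ V'.Nonempty ∧
      ∀ n : ℕ, (U' ∩ S^[n] ⁻¹' V').Nonempty →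
        ∀ j < L, (U ∩ S^[m + n + j] ⁻¹' V).Nonempty := by
    intro L
    induction L with
    | zero => exact ⟨U, V, hU, hV, nU, nV, fun _ _ j hj => absurd hj (Nat.not_lt_zero j)⟩
    | succ L ih =>
      obtain ⟨U', V', hU', hV', nU', nV', h'⟩ := ih
      obtain ⟨U'', V'', hU'', hV'', nU'', nV'', h''⟩ := hS.exists_subset_inter hSc hU' hV' hU
        (hV.preimage (hSc.iterate (m + L))) nU' nV' nU (nV.preimage (hSs.iterate (m + L)))
      refine ⟨U'', V'', hU'', hV'', nU'', nV'', fun n hn j hj => ?_⟩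
      obtain ⟨h₁, u, hu, huV⟩ := h'' n hn
      rcases Nat.lt_succ_iff_lt_or_eq.1 hj with hj | rfl
      · exact h' n h₁ j hj
      · refine ⟨u, hu, ?_⟩
        rw [mem_preimage, mem_preimage, ← Function.iterate_add_apply] at huV
        rwa [mem_preimage, show m + n + j = m + j + n by ring]
  obtain ⟨U', V', hU', hV', nU', nV', h'⟩ := key L
  obtain ⟨n, hn, -⟩ := hS U' V' U' V' hU' hV' hU' hV' nU' nV' nU' nV'
  exact ⟨m + n, Nat.le_add_right _ _, h' n hn⟩

theorem MinimalSystem.exists_common_time [CompactSpace X] {T : X → X} {S : Y → Y}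
    (hT : MinimalSystem T)
    (hTc : Continuous T) (hS : BoxMixing S) (hSc : Continuous S) (hSs : Function.Surjective S)
    {A : Set X} {U V : Set Y} (hA : IsOpen A) (nA : A.Nonempty) (hU : IsOpen U) (hV : IsOpen V)
    (nU : U.Nonempty) (nV : V.Nonempty) (x : X) (m : ℕ) :
    ∃ n ≥ m, T^[n] x ∈ A ∧ (U ∩ S^[n] ⁻¹' V).Nonempty := by
  obtain ⟨L, hL⟩ := hT.exists_visit_bound hTc hA nA
  obtain ⟨a, ha, haL⟩ := hS.exists_interval hSc hSs hU hV nU nV m L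
  obtain ⟨j, hj, hx⟩ := hL (T^[a] x)
  refine ⟨a + j, ha.trans (Nat.le_add_right _ _), ?_, haL j hj⟩
  rwa [Nat.add_comm, Function.iterate_add_apply]

theorem BoxMixing.iterate {S : Y → Y} (hS : BoxMixing S) (hSc : Continuous S)
    (hSs : Function.Surjective S) {d : ℕ} (hd : 0 < d) : BoxMixing S^[d] := by
  intro U₁ V₁ U₂ V₂ hU₁ hV₁ hU₂ hV₂ nU₁ nV₁ nU₂ nV₂
  obtain ⟨U, V, hU, hV, nU, nV, h⟩ :=
    hS.exists_subset_inter hSc hU₁ hV₁ hU₂ hV₂ nU₁ nV₁ nU₂ nV₂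
  obtain ⟨a, -, ha⟩ := hS.exists_interval hSc hSs hU hV nU nV 0 (d + 1)
  have hlt : d - a % d < d + 1 := by omega
  have hq : a + (d - a % d) = d * (a / d + 1) := by
    have h1 := Nat.div_add_mod a d
    have h2 := Nat.mod_lt a hd
    rw [Nat.mul_add]; omega
  refine ⟨a / d + 1, ?_⟩
  rw [← Function.iterate_mul, ← hq]
  exact h _ (ha _ hlt)

/-- A weakly mixing minimal system is totally minimal. -/
theorem MinimalSystem.iterate_of_boxMixing [CompactSpace Y] [T2Space Y] {S : Y → Y}
    (hm : MinimalSystem S)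
    (hS : BoxMixing S) (hSc : Continuous S) {d : ℕ} (hd : 0 < d) : MinimalSystem S^[d] := by
  intro y
  have hSs := hm.surjective hSc
  have : Nonempty Y := ⟨y⟩
  set C : Set Y := closure (range fun n : ℕ => (S^[d])^[n] y) with hC
  have hCinv : MapsTo S^[d] C C := by
    refine MapsTo.closure ?_ (hSc.iterate d)
    rintro _ ⟨n, rfl⟩
    exact ⟨n + 1, Function.iterate_succ_apply' _ _ _⟩
  have hCi : ∀ i : ℕ, IsClosed (S^[i] '' C) := fun i =>
    (isClosed_closure.isCompact.image (hSc.iterate i)).isClosed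
  obtain ⟨i, hi⟩ := nonempty_interior_of_iUnion_of_closed
    (f := fun i : Fin d => S^[i] '' C) (fun i => hCi i) (by
      have hcl : IsClosed (⋃ i : Fin d, S^[i] '' C) := isClosed_iUnion_of_finite fun i => hCi i
      rw [← hcl.closure_eq, ← Set.univ_subset_iff, ← (hm y).closure_eq]
      refine closure_mono ?_
      rintro _ ⟨n, rfl⟩
      refine mem_iUnion.2 ⟨⟨n % d, Nat.mod_lt n hd⟩, (S^[d])^[n / d] y,
        subset_closure ⟨n / d, rfl⟩, ?_⟩
      simp only
      rw [← Function.iterate_mul, ← Function.iterate_add_apply, Nat.mod_add_div])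
  have hCiinv : MapsTo S^[d] (S^[i] '' C) (S^[i] '' C) := by
    rintro _ ⟨c, hc, rfl⟩
    refine ⟨S^[d] c, hCinv hc, ?_⟩
    rw [← Function.iterate_add_apply, ← Function.iterate_add_apply, Nat.add_comm]
  have hfull : S^[i] '' C = univ := by
    by_contra hne
    have hVn : (S^[i] '' C)ᶜ.Nonempty := nonempty_compl.2 hne
    obtain ⟨n, ⟨z, hz, hzn⟩, -⟩ := hS.iterate hSc hSs hd _ _ _ _ isOpen_interior
      (hCi i).isOpen_compl isOpen_interior (hCi i).isOpen_compl hi hVn hi hVn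
    exact hzn (hCiinv.iterate n (interior_subset hz))
  intro z
  obtain ⟨w, hw⟩ := hSs.iterate (d - i) z
  obtain ⟨c, hc, rfl⟩ : w ∈ S^[i] '' C := hfull ▸ mem_univ w
  rw [← Function.iterate_add_apply, Nat.sub_add_cancel i.2.le] at hw
  exact hw ▸ hCinv hc

end Dynamics

section FiniteExtension

variable {X : Type*}

/-- There are arbitrarily late times at which the orbit of `z` is in `A` while some point of `U`
is moved into `B`. -/
def FrequentlyHits (T : X → X) (A B : Set X) (z : X) (U : Set X) : Prop :=
  ∀ m : ℕ, ∃ n ≥ m, T^[n] z ∈ A ∧ (U ∩ T^[n] ⁻¹' B).Nonempty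

/-- From some time on, `O` and `U` do not meet `A` and `B` simultaneously. -/
def EventuallyMisses (T : X → X) (A B O U : Set X) : Prop :=
  ∃ m : ℕ, ∀ n ≥ m, ¬ ((O ∩ T^[n] ⁻¹' A).Nonempty ∧ (U ∩ T^[n] ⁻¹' B).Nonempty)

variable {T : X → X} {A B : Set X}

theorem FrequentlyHits.mono {z : X} {U V : Set X} (h : FrequentlyHits T A B z U)
    (hUV : U ⊆ V) : FrequentlyHits T A B z V := fun m =>
  let ⟨n, hn, hz, hU⟩ := h m
  ⟨n, hn, hz, hU.mono (inter_subset_inter_left _ hUV)⟩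

theorem FrequentlyHits.push {z : X} {U V : Set X} (l : ℕ) (h : FrequentlyHits T A B z U)
    (hUV : U ⊆ T^[l] ⁻¹' V) : FrequentlyHits T A B (T^[l] z) V := by
  intro m
  obtain ⟨n, hn, hz, u, hu, huB⟩ := h (m + l)
  obtain ⟨k, rfl⟩ := Nat.exists_eq_add_of_le' (le_of_add_le_right hn)
  refine ⟨k, by omega, ?_, T^[l] u, hUV hu, ?_⟩
  · rwa [← Function.iterate_add_apply]
  · rwa [mem_preimage, ← Function.iterate_add_apply]

theorem FrequentlyHits.pull {z : X} {U V : Set X} (l : ℕ)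
    (h : FrequentlyHits T A B (T^[l] z) V) (hUV : V ⊆ T^[l] '' U) :
    FrequentlyHits T A B z U := by
  intro m
  obtain ⟨n, hn, hz, v, hv, hvB⟩ := h m
  obtain ⟨u, hu, rfl⟩ := hUV hv
  refine ⟨n + l, by omega, ?_, u, hu, ?_⟩
  · rwa [Function.iterate_add_apply]
  · rwa [mem_preimage, Function.iterate_add_apply]

theorem EventuallyMisses.not_frequentlyHits {O U : Set X} (h : EventuallyMisses T A B O U)
    {z : X} (hz : z ∈ O) : ¬ FrequentlyHits T A B z U := by
  intro hf
  obtain ⟨m, hm⟩ := h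
  obtain ⟨n, hn, hzA, hU⟩ := hf m
  exact hm n hn ⟨⟨z, hz, hzA⟩, hU⟩

theorem EventuallyMisses.union {O O' U V : Set X} (h : EventuallyMisses T A B O U)
    (h' : EventuallyMisses T A B O' V) (hO : O' ⊆ O) : EventuallyMisses T A B O' (U ∪ V) := by
  obtain ⟨m, hm⟩ := h
  obtain ⟨m', hm'⟩ := h'
  refine ⟨max m m', fun n hn => ?_⟩
  rintro ⟨hOA, u, hu | hu, huB⟩
  · exact hm n (le_of_max_le_left hn) ⟨hOA.mono (inter_subset_inter_left _ hO), u, hu, huB⟩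
  · exact hm' n (le_of_max_le_right hn) ⟨hOA, u, hu, huB⟩

variable [TopologicalSpace X]

/-- Every nonempty open subset of `U` is hit frequently. -/
def LocallyFrequentlyHits (T : X → X) (A B : Set X) (z : X) (U : Set X) : Prop :=
  ∀ U' ⊆ U, IsOpen U' → U'.Nonempty → FrequentlyHits T A B z U'

variable {Y : Type*} [TopologicalSpace Y] [CompactSpace X] [CompactSpace Y] [T2Space X]
  [T2Space Y] {S : Y → Y} {π : X → Y}

theorem frequentlyHits_preimage (hT : MinimalSystem T) (hTc : Continuous T)
    (hS : MinimalSystem S) (hSc : Continuous S) (hmix : BoxMixing S) (hπ : Continuous π)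
    (hπs : Function.Surjective π) (hfac : ∀ x, π (T x) = S (π x)) (hA : IsOpen A)
    (nA : A.Nonempty) (hB : IsOpen B) (nB : B.Nonempty) {V : Set Y} (hV : IsOpen V)
    (nV : V.Nonempty) (x : X) : FrequentlyHits T A B x (π ⁻¹' V) := by
  intro m
  have hSs := hS.surjective hSc
  obtain ⟨n, hn, hx, hVn⟩ := hT.exists_common_time hTc hmix hSc hSs hA nA hV isOpen_interior nV
    (hT.interior_image_nonempty hTc hS hSc hπ hπs hfac hB nB) x m
  obtain ⟨V', hV', ⟨v, hv⟩, hsub⟩ := hS.exists_preimage_iterate_subset hSc n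
    (hV.inter (isOpen_interior.preimage (hSc.iterate n))) hVn
  obtain ⟨v₀, rfl⟩ := hSs.iterate n v
  obtain ⟨w, hwB, hw⟩ := interior_subset (hsub hv).2
  obtain ⟨u, rfl⟩ := (hT.surjective hTc).iterate n w
  rw [semiconj_iterate hfac] at hw
  exact ⟨n, hn, hx, u, (hsub (show S^[n] (π u) ∈ V' from hw ▸ hv)).1, hwB⟩

/-- There is a base region `V` over which the set hit together with any nonempty open part of `O`
is, up to a nowhere dense set, the complement of a fixed set `W`. -/
theorem exists_stable_region (hT : MinimalSystem T) (hTc : Continuous T)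
    (hS : MinimalSystem S) (hSc : Continuous S) (hπ : Continuous π)
    (hπs : Function.Surjective π) (hfac : ∀ x, π (T x) = S (π x)) (N : ℕ)
    (hfin : ∀ y, (π ⁻¹' {y}).Finite) (hcard : ∀ y, (π ⁻¹' {y}).ncard ≤ N)
    {U₁ : Set X} (hU₁ : IsOpen U₁) (nU₁ : U₁.Nonempty) :
    ∃ (O W : Set X) (V : Set Y), IsOpen O ∧ O.Nonempty ∧ O ⊆ U₁ ∧ IsOpen W ∧ IsOpen V ∧
      V.Nonempty ∧ EventuallyMisses T A B O W ∧
      ∀ O' ⊆ O, IsOpen O' → O'.Nonempty → ∀ U ⊆ π ⁻¹' V \ closure W, IsOpen U → U.Nonempty →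
        ¬ EventuallyMisses T A B O' U := by
  classical
  let P : ℕ → Prop := fun s => ∃ (O W : Set X) (V : Set Y), IsOpen O ∧ O.Nonempty ∧ O ⊆ U₁ ∧
    IsOpen W ∧ IsOpen V ∧ V.Nonempty ∧ EventuallyMisses T A B O W ∧
    ∀ y ∈ V, s ≤ (W ∩ π ⁻¹' {y}).ncard
  obtain ⟨x₁, hx₁⟩ := nU₁
  have hP0 : P 0 := ⟨U₁, ∅, univ, hU₁, ⟨x₁, hx₁⟩, subset_rfl, isOpen_empty, isOpen_univ,
    ⟨π x₁, mem_univ _⟩, ⟨0, by simp⟩, by simp⟩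
  have hPN : ∀ s, P s → s ≤ N := by
    rintro s ⟨O, W, V, -, -, -, -, -, ⟨y, hy⟩, -, h⟩
    exact (h y hy).trans ((ncard_le_ncard inter_subset_right (hfin y)).trans (hcard y))
  obtain ⟨s, hs, hs'⟩ : ∃ s, P s ∧ ¬ P (s + 1) := by
    by_contra! h
    have : ∀ s, P s := fun s => Nat.rec hP0 h s
    exact absurd (hPN _ (this (N + 1))) (by omega)
  obtain ⟨O, W, V, hO, nO, hOU, hW, hV, nV, hOW, hVs⟩ := hs
  refine ⟨O, W, V, hO, nO, hOU, hW, hV, nV, hOW, ?_⟩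
  intro O' hO'O hO' nO' U hUsub hU nU hmiss
  refine hs' ⟨O', W ∪ U, interior (π '' U), hO', nO', hO'O.trans hOU, hW.union hU,
    isOpen_interior, hT.interior_image_nonempty hTc hS hSc hπ hπs hfac hU nU,
    hOW.union hmiss hO'O, ?_⟩
  intro y hy
  obtain ⟨u, hu, rfl⟩ := interior_subset hy
  have huV : π u ∈ V := (hUsub hu).1
  have hnot : u ∉ W ∩ π ⁻¹' {π u} := fun h => (hUsub hu).2 (subset_closure h.1)
  calc s + 1 ≤ (W ∩ π ⁻¹' {π u}).ncard + 1 := Nat.succ_le_succ (hVs _ huV)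
    _ = (insert u (W ∩ π ⁻¹' {π u})).ncard :=
      (ncard_insert_of_notMem hnot ((hfin _).subset inter_subset_right)).symm
    _ ≤ _ := by
      refine ncard_le_ncard ?_ ((hfin _).subset inter_subset_right)
      rintro z (rfl | hz)
      · exact ⟨Or.inr hu, rfl⟩
      · exact ⟨Or.inl hz.1, hz.2⟩

theorem LocallyFrequentlyHits.preimage (hT : MinimalSystem T) (hTc : Continuous T) {z : X}
    {l : ℕ} {U : Set X} (h : LocallyFrequentlyHits T A B (T^[l] z) U) :
    LocallyFrequentlyHits T A B z (T^[l] ⁻¹' U) := by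
  intro U' hU' hU'o hU'n
  refine (h (interior (T^[l] '' U')) ?_ isOpen_interior
    (hT.interior_image_iterate_nonempty hTc l hU'o hU'n)).pull l interior_subset
  exact interior_subset.trans (image_subset_iff.2 hU')

/-- Comparison of two points which simultaneously return to a stable region. -/
theorem LocallyFrequentlyHits.transfer (hT : MinimalSystem T) (hTc : Continuous T)
    (hS : MinimalSystem S) (hSc : Continuous S) (hπ : Continuous π)
    (hπs : Function.Surjective π) (hfac : ∀ x, π (T x) = S (π x)) {W U : Set X} {V : Set Y}
    {z₁ z₂ : X} (hV : IsOpen V) (hW : IsOpen W)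
    (htime : ∀ V' : Set Y, IsOpen V' → V'.Nonempty → ∃ n, (V' ∩ S^[n] ⁻¹' V).Nonempty ∧
      ¬ FrequentlyHits T A B (T^[n] z₁) W ∧
      LocallyFrequentlyHits T A B (T^[n] z₂) (π ⁻¹' V \ closure W))
    (h : LocallyFrequentlyHits T A B z₁ U) : LocallyFrequentlyHits T A B z₂ U := by
  intro U' hU'U hU' nU'
  obtain ⟨n, ⟨y, hy, hyV⟩, hn₁, hn₂⟩ := htime _ isOpen_interior
    (hT.interior_image_nonempty hTc hS hSc hπ hπs hfac hU' nU')
  obtain ⟨u, hu, rfl⟩ := interior_subset hy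
  have hopen : IsOpen (U' ∩ T^[n] ⁻¹' (π ⁻¹' V)) :=
    hU'.inter ((hV.preimage hπ).preimage (hTc.iterate n))
  have hne : (U' ∩ T^[n] ⁻¹' (π ⁻¹' V)).Nonempty :=
    ⟨u, hu, by rwa [mem_preimage, mem_preimage, semiconj_iterate hfac]⟩
  have hdisj : Disjoint (interior (T^[n] '' (U' ∩ T^[n] ⁻¹' (π ⁻¹' V)))) W := by
    rw [Set.disjoint_left]
    intro w hw hwW
    obtain ⟨v, hv, rfl⟩ := interior_subset hw
    refine hn₁ ((h (U' ∩ T^[n] ⁻¹' W) (inter_subset_left.trans hU'U)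
      (hU'.inter (hW.preimage (hTc.iterate n))) ⟨v, hv.1, hwW⟩).push n inter_subset_right)
  refine ((hn₂ _ ?_ isOpen_interior
    (hT.interior_image_iterate_nonempty hTc n hopen hne)).pull n interior_subset).mono
    inter_subset_left
  intro w hw
  refine ⟨?_, Set.disjoint_left.1 (hdisj.closure_right isOpen_interior) hw⟩
  obtain ⟨v, hv, rfl⟩ := interior_subset hw
  exact hv.2

theorem MinimalSystem.dense_preimage_iterate (hT : MinimalSystem T) (hTc : Continuous T)
    (l : ℕ) {D : Set X} (hD : Dense D) : Dense (T^[l] ⁻¹' D) := by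
  rw [dense_iff_inter_open]
  intro U hU nU
  obtain ⟨_, hd, hw⟩ := hD.exists_mem_open isOpen_interior
    (hT.interior_image_iterate_nonempty hTc l hU nU)
  obtain ⟨u, hu, rfl⟩ := interior_subset hw
  exact ⟨u, hu, hd⟩

/-- A generic point of `O` hits `H` locally frequently at each of its visits to `O`. -/
theorem exists_mem_forall_iterate_locallyFrequentlyHits [SecondCountableTopology X]
    (hT : MinimalSystem T) (hTc : Continuous T) (hA : IsOpen A) {O H O₁ : Set X}
    (hO : IsOpen O)
    (h : ∀ O' ⊆ O, IsOpen O' → O'.Nonempty → ∀ U ⊆ H, IsOpen U → U.Nonempty →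
        ¬ EventuallyMisses T A B O' U) (hO₁ : IsOpen O₁) (nO₁ : O₁.Nonempty) :
    ∃ x ∈ O₁, ∀ l, T^[l] x ∈ O → LocallyFrequentlyHits T A B (T^[l] x) H := by
  let b := TopologicalSpace.countableBasis X
  let ι := {U : Set X // U ∈ b ∧ U ⊆ H ∧ U.Nonempty}
  have : Countable ι :=
    ((TopologicalSpace.countable_countableBasis X).mono fun U hU => hU.1 :
      {U : Set X | U ∈ b ∧ U ⊆ H ∧ U.Nonempty}.Countable).to_subtype
  let D : ι → ℕ → Set X := fun U m =>
    {x | ∃ n ≥ m, T^[n] x ∈ A ∧ (U.1 ∩ T^[n] ⁻¹' B).Nonempty} ∪ (closure O)ᶜ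
  have hDo : ∀ U m, IsOpen (D U m) := by
    intro U m
    refine IsOpen.union ?_ isClosed_closure.isOpen_compl
    have : {x | ∃ n ≥ m, T^[n] x ∈ A ∧ (U.1 ∩ T^[n] ⁻¹' B).Nonempty} =
        ⋃ n ∈ {n | n ≥ m ∧ (U.1 ∩ T^[n] ⁻¹' B).Nonempty}, T^[n] ⁻¹' A := by
      ext x
      simp only [mem_ofPred_eq, mem_iUnion, mem_preimage, exists_prop]
      exact exists_congr fun n => by tauto
    rw [this]
    exact isOpen_biUnion fun n _ => hA.preimage (hTc.iterate n)
  have hDd : ∀ U m, Dense (D U m) := by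
    intro U m
    rw [dense_iff_inter_open]
    intro G hG nG
    by_cases hGO : (G ∩ O).Nonempty
    · have := h (G ∩ O) inter_subset_right (hG.inter hO) hGO U.1 U.2.2.1
        (TopologicalSpace.isOpen_of_mem_countableBasis U.2.1) U.2.2.2
      simp only [EventuallyMisses, not_exists, not_forall, not_not] at this
      obtain ⟨n, hn, ⟨x, hx, hxA⟩, hU⟩ := this m
      exact ⟨x, hx.1, Or.inl ⟨n, hn, hxA, hU⟩⟩
    · obtain ⟨x, hx⟩ := nG
      refine ⟨x, hx, Or.inr fun hxO => hGO ?_⟩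
      exact mem_closure_iff.1 hxO G hG hx
  have hdense : Dense (⋂ p : ℕ × ι × ℕ, T^[p.1] ⁻¹' D p.2.1 p.2.2) :=
    dense_iInter_of_isOpen (fun p => (hDo _ _).preimage (hTc.iterate _))
      fun p => hT.dense_preimage_iterate hTc _ (hDd _ _)
  obtain ⟨x, hx, hxO₁⟩ := hdense.exists_mem_open hO₁ nO₁
  refine ⟨x, hxO₁, fun l hl U' hU'H hU' nU' => ?_⟩
  obtain ⟨u, hu⟩ := nU'
  obtain ⟨U, hUb, huU, hUU'⟩ :=
      (TopologicalSpace.isBasis_countableBasis X).exists_subset_of_mem_open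
    hu hU'
  refine FrequentlyHits.mono (U := U) (fun m => ?_) hUU'
  have hmem := mem_iInter.1 hx (l, ⟨U, hUb, hUU'.trans hU'H, ⟨u, huU⟩⟩, m)
  exact hmem.resolve_right fun h' => h' (subset_closure hl)

/-- A totally minimal extension with finite fibres of bounded cardinality of a weakly mixing
minimal system is weakly mixing. -/
theorem boxMixing_of_finite_extension [SecondCountableTopology X]
    (hT : ∀ d > 0, MinimalSystem T^[d]) (hTc : Continuous T)
    (hS : MinimalSystem S) (hSc : Continuous S) (hmix : BoxMixing S) (hπ : Continuous π)
    (hπs : Function.Surjective π) (hfac : ∀ x, π (T x) = S (π x)) (N : ℕ)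
    (hfin : ∀ y, (π ⁻¹' {y}).Finite) (hcard : ∀ y, (π ⁻¹' {y}).ncard ≤ N) :
    BoxMixing T := by
  intro U₁ A U₂ B hU₁ hA hU₂ hB nU₁ nA nU₂ nB
  have hT1 : MinimalSystem T := hT 1 one_pos
  have hSs := hS.surjective hSc
  obtain ⟨O, W, V, hO, nO, hOU, hW, hV, nV, hOW, hstab⟩ := exists_stable_region (A := A)
    (B := B) hT1 hTc hS hSc hπ hπs hfac N hfin hcard hU₁ nU₁
  have hHo : IsOpen (π ⁻¹' V \ closure W) := (hV.preimage hπ).sdiff isClosed_closure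
  have hHn : (π ⁻¹' V \ closure W).Nonempty := by
    obtain ⟨x, hx⟩ := nO
    rw [nonempty_iff_ne_empty, Ne, sdiff_eq_empty]
    intro hsub
    refine hOW.not_frequentlyHits hx fun m => ?_
    obtain ⟨n, hn, hxA, w, hwV, hwB⟩ := frequentlyHits_preimage hT1 hTc hS hSc hmix hπ hπs hfac
      hA nA hB nB hV nV x m
    obtain ⟨w', hw', hw'W⟩ := mem_closure_iff.1 (hsub hwV) _ (hB.preimage (hTc.iterate n)) hwB
    exact ⟨n, hn, hxA, w', hw'W, hw'⟩
  obtain ⟨d, hd, hdO⟩ : ∃ d > 0, (O ∩ T^[d] ⁻¹' O).Nonempty := by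
    obtain ⟨x, hx⟩ := nO
    obtain ⟨_, ⟨j, rfl⟩, hj⟩ := (hT1 (T x)).exists_mem_open hO ⟨x, hx⟩
    exact ⟨j + 1, Nat.succ_pos j, x, hx, by rwa [mem_preimage, Function.iterate_succ_apply]⟩
  have hOd : IsOpen (O ∩ T^[d] ⁻¹' O) := hO.inter (hO.preimage (hTc.iterate d))
  obtain ⟨x, hxO, hx⟩ := exists_mem_forall_iterate_locallyFrequentlyHits hT1 hTc hA hO hstab
    hOd hdO
  have htime : ∀ V' : Set Y, IsOpen V' → V'.Nonempty →
      ∃ n, (V' ∩ S^[n] ⁻¹' V).Nonempty ∧ T^[n] x ∈ O ∧ T^[n] (T^[d] x) ∈ O := by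
    intro V' hV' nV'
    obtain ⟨n, -, hn, hVn⟩ := hT1.exists_common_time hTc hmix hSc hSs hOd hdO hV' hV nV' nV x 0
    refine ⟨n, hVn, hn.1, ?_⟩
    have := hn.2
    rwa [mem_preimage, ← Function.iterate_add_apply, Nat.add_comm,
      Function.iterate_add_apply] at this
  have hx' : ∀ n, T^[n] (T^[d] x) ∈ O →
      LocallyFrequentlyHits T A B (T^[n] (T^[d] x)) (π ⁻¹' V \ closure W) := by
    intro n hn
    rw [← Function.iterate_add_apply] at hn ⊢
    exact hx _ hn
  have hfrom : ∀ U, LocallyFrequentlyHits T A B x U → LocallyFrequentlyHits T A B (T^[d] x) U :=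
    fun U => LocallyFrequentlyHits.transfer hT1 hTc hS hSc hπ hπs hfac hV hW
      fun V' hV' nV' => by
        obtain ⟨n, h₁, h₂, h₃⟩ := htime V' hV' nV'
        exact ⟨n, h₁, hOW.not_frequentlyHits h₂, hx' n h₃⟩
  let E : Set X := ⋃₀ {U | IsOpen U ∧ LocallyFrequentlyHits T A B x U}
  have hEo : IsOpen E := isOpen_sUnion fun U hU => hU.1
  have hEinv : T^[d] ⁻¹' E ⊆ E := by
    rintro z ⟨U, ⟨hUo, hU⟩, hz⟩
    exact ⟨T^[d] ⁻¹' U, ⟨hUo.preimage (hTc.iterate d), (hfrom U hU).preimage hT1 hTc⟩, hz⟩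
  have hEn : E.Nonempty := hHn.mono fun z hz => ⟨_, ⟨hHo, hx 0 hxO.1⟩, hz⟩
  have hEuniv : ∀ z, z ∈ E := by
    intro z
    obtain ⟨_, ⟨k, rfl⟩, hk⟩ := (hT d hd z).exists_mem_open hEo hEn
    simp only at hk
    induction k with
    | zero => exact hk
    | succ k ih => exact ih (hEinv (by rwa [mem_preimage, ← Function.iterate_succ_apply' T^[d]]))
  obtain ⟨u, hu⟩ := nU₂
  obtain ⟨U, ⟨hUo, hU⟩, huU⟩ := hEuniv u
  obtain ⟨n, -, hn, hnB⟩ := hU (U ∩ U₂) inter_subset_left (hUo.inter hU₂) ⟨u, huU, hu⟩ 0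
  exact ⟨n, ⟨x, hOU hxO.1, hn⟩, hnB.mono (inter_subset_inter_left _ inter_subset_right)⟩

end FiniteExtension

section MinimalSubset

variable {X : Type*} [TopologicalSpace X] {T : X → X} {N : Set X}

theorem IsMinimalSubset.subset_of_closed (hN : IsMinimalSubset T N) {C : Set X}
    (hC : IsClosed C) (hCT : MapsTo T C C) (hne : (N ∩ C).Nonempty) : N ⊆ C := by
  obtain ⟨x, hxN, hxC⟩ := hne
  intro y hy
  refine hC.closure_subset_iff.2 ?_ (hN.2.2.2 x hxN y hy)
  rintro _ ⟨n, rfl⟩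
  exact hCT.iterate n hxC

theorem exists_isMinimalSubset [CompactSpace X] {C : Set X} (hC : IsClosed C)
    (hCT : MapsTo T C C) (hne : C.Nonempty) (hTc : Continuous T) :
    ∃ N ⊆ C, IsMinimalSubset T N := by
  let F : Set (Set X) := {D | IsClosed D ∧ MapsTo T D D ∧ D.Nonempty}
  obtain ⟨N, hNC, hN⟩ := zorn_superset_nonempty F (by
    intro c hcF hc hcn
    refine ⟨⋂₀ c, ⟨isClosed_sInter fun D hD => (hcF hD).1, ?_, ?_⟩,
      fun D hD => sInter_subset_of_mem hD⟩
    · intro x hx D hD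
      exact (hcF hD).2.1 (hx D hD)
    · have : Nonempty c := hcn.to_subtype
      exact IsCompact.nonempty_sInter_of_directed_nonempty_isCompact_isClosed
        (fun D hD D' hD' => (hc.total hD hD').elim (fun h => ⟨D, hD, subset_rfl, h⟩)
          fun h => ⟨D', hD', h, subset_rfl⟩) (fun D hD => (hcF hD).2.2)
        (fun D hD => (hcF hD).1.isCompact) (fun D hD => (hcF hD).1))
    C ⟨hC, hCT, hne⟩
  refine ⟨N, hNC, hN.prop.2.2, hN.prop.1, hN.prop.2.1, fun x hx y hy => ?_⟩
  have hsub : closure (range fun n : ℕ => T^[n] x) ⊆ N :=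
    hN.prop.1.closure_subset_iff.2 (by rintro _ ⟨n, rfl⟩; exact hN.prop.2.1.iterate n hx)
  refine hN.le_of_le (y := closure (range fun n : ℕ => T^[n] x))
    ⟨isClosed_closure, MapsTo.closure ?_ hTc, x, subset_closure ⟨0, rfl⟩⟩ hsub hy
  rintro _ ⟨n, rfl⟩
  exact ⟨n + 1, Function.iterate_succ_apply' _ _ _⟩

theorem IsMinimalSubset.image [CompactSpace X] [T2Space X] {R : X → X}
    (hN : IsMinimalSubset R N) (hTc : Continuous T) (hcomm : Function.Commute T R) :
    IsMinimalSubset R (T '' N) := by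
  obtain ⟨hne, hcl, hmaps, hdense⟩ := hN
  refine ⟨hne.image T, (hcl.isCompact.image hTc).isClosed, ?_, ?_⟩
  · rintro _ ⟨x, hx, rfl⟩
    exact ⟨R x, hmaps hx, hcomm x⟩
  · rintro _ ⟨x, hx, rfl⟩ _ ⟨y, hy, rfl⟩
    refine closure_mono ?_ (image_closure_subset_closure_image hTc ⟨y, hdense x hx y hy, rfl⟩)
    rintro _ ⟨_, ⟨n, rfl⟩, rfl⟩
    exact ⟨n, ((hcomm.iterate_right n) x).symm⟩

/-- Each point of a minimal set lies in a minimal set of an iterate of the map; if the latter is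
smaller, its complement contains another minimal set of that iterate. -/
theorem IsMinimalSubset.exists_iterate [CompactSpace X] [T2Space X] (hN : IsMinimalSubset T N)
    (hTc : Continuous T) {e : ℕ} (he : 0 < e) {x : X} (hx : x ∈ N) :
    ∃ N' ⊆ N, x ∈ N' ∧ IsMinimalSubset T^[e] N' ∧
      (N' = N ∨ ∃ N'' ⊆ N, IsMinimalSubset T^[e] N'' ∧ Disjoint N' N'') := by
  obtain ⟨hne, hcl, hmaps, -⟩ := id hN
  obtain ⟨N₀, hN₀N, hN₀⟩ := exists_isMinimalSubset hcl (hmaps.iterate e) hne (hTc.iterate e)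
  have hcomm : ∀ i, Function.Commute T^[i] T^[e] := fun i =>
    (Function.Commute.iterate_iterate_self T i e)
  have hNi : ∀ i, IsMinimalSubset T^[e] (T^[i] '' N₀) := fun i =>
    hN₀.image (hTc.iterate i) (hcomm i)
  have hsub : ∀ i, T^[i] '' N₀ ⊆ N := fun i =>
    ((hmaps.iterate i).mono_left hN₀N).image_subset
  have hcover : N ⊆ ⋃ i : Fin e, T^[i] '' N₀ := by
    obtain ⟨x₀, hx₀⟩ := hN₀.1
    refine hN.subset_of_closed (isClosed_iUnion_of_finite fun i => (hNi i).2.1) ?_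
      ⟨x₀, hN₀N hx₀, mem_iUnion.2 ⟨⟨0, he⟩, x₀, hx₀, rfl⟩⟩
    intro z hz
    obtain ⟨⟨i, hi⟩, w, hw, rfl⟩ := mem_iUnion.1 hz
    simp only
    rw [← Function.iterate_succ_apply' T]
    rcases Nat.lt_or_ge (i + 1) e with h | h
    · exact mem_iUnion.2 ⟨⟨i + 1, h⟩, w, hw, rfl⟩
    · obtain rfl : i + 1 = e := le_antisymm hi h
      exact mem_iUnion.2 ⟨⟨0, he⟩, _, hN₀.2.2.1 hw, rfl⟩
  obtain ⟨i, hi⟩ := mem_iUnion.1 (hcover hx)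
  have hTN : IsMinimalSubset T^[e] (T '' (T^[i] '' N₀)) := (hNi i).image hTc (hcomm 1)
  refine ⟨_, hsub i, hi, hNi i, ?_⟩
  by_cases hd : Disjoint (T^[i] '' N₀) (T '' (T^[i] '' N₀))
  · exact Or.inr ⟨_, (hmaps.mono_left (hsub i)).image_subset, hTN, hd⟩
  · left
    rw [Set.not_disjoint_iff_nonempty_inter] at hd
    refine (hsub i).antisymm (hN.subset_of_closed (hNi i).2.1 ?_ ⟨x, hx, hi⟩)
    rw [mapsTo_iff_image_subset]
    exact hTN.subset_of_closed (hNi i).2.1 (hNi i).2.2.1 (by rwa [inter_comm])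

theorem IsMinimalSubset.minimalSystem_restrict (hN : IsMinimalSubset T N) :
    MinimalSystem (hN.2.2.1.restrict T N N) := by
  intro x y
  rw [closure_subtype]
  refine closure_mono ?_ (hN.2.2.2 x x.2 y y.2)
  rintro _ ⟨n, rfl⟩
  exact ⟨_, ⟨n, rfl⟩, hN.2.2.1.coe_iterate_restrict x n⟩

variable {Y : Type*} [TopologicalSpace Y] [CompactSpace X] [T2Space Y]

theorem IsMinimalSubset.image_eq_univ {S : Y → Y} {π : X → Y} (hN : IsMinimalSubset T N)
    (hS : MinimalSystem S) (hπ : Continuous π) (hfac : ∀ x, π (T x) = S (π x)) :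
    π '' N = univ := by
  obtain ⟨⟨x, hx⟩, hcl, hmaps, -⟩ := hN
  refine eq_univ_of_forall fun y =>
    (hcl.isCompact.image hπ).isClosed.closure_subset_iff.2 ?_ (hS (π x) y)
  rintro _ ⟨n, rfl⟩
  exact ⟨T^[n] x, hmaps.iterate n hx, semiconj_iterate hfac n x⟩

/-- In a finite extension of a weakly mixing minimal system, each point of a minimal set lies in a
totally minimal set of some iterate. -/
theorem IsMinimalSubset.exists_totally_minimal [T2Space X] [CompactSpace Y] {S : Y → Y} {π : X → Y}
    (hN : IsMinimalSubset T N) (hTc : Continuous T) (hS : MinimalSystem S) (hSc : Continuous S)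
    (hmix : BoxMixing S) (hπ : Continuous π) (hfac : ∀ x, π (T x) = S (π x))
    (hfin : ∀ y, (π ⁻¹' {y}).Finite) {x : X} (hx : x ∈ N) :
    ∃ d > 0, ∃ N' ⊆ N, x ∈ N' ∧ ∀ e > 0, IsMinimalSubset (T^[d])^[e] N' := by
  let P : ℕ → Prop := fun s => ∃ d > 0, ∃ N' ⊆ N, x ∈ N' ∧ IsMinimalSubset T^[d] N' ∧
    (N' ∩ π ⁻¹' {π x}).ncard = s
  have hP : ∃ s, P s := ⟨_, 1, one_pos, N, subset_rfl, hx, hN, rfl⟩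
  classical
  obtain ⟨d, hd, N', hN'N, hxN', hN', hs⟩ := Nat.find_spec hP
  refine ⟨d, hd, N', hN'N, hxN', fun e he => ?_⟩
  obtain ⟨N₁, hN₁, hxN₁, hN₁m, rfl | ⟨N₂, hN₂, hN₂m, hdisj⟩⟩ :=
    hN'.exists_iterate (hTc.iterate d) he hxN'
  · exact hN₁m
  exfalso
  rw [← Function.iterate_mul] at hN₁m hN₂m
  have hde : 0 < d * e := Nat.mul_pos hd he
  have himg : π x ∈ π '' N₂ := by
    rw [hN₂m.image_eq_univ (hS.iterate_of_boxMixing hmix hSc hde) hπ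
      (semiconj_iterate hfac (d * e))]
    exact mem_univ _
  obtain ⟨z, hz, hzx⟩ := himg
  refine Nat.find_min hP (m := (N₁ ∩ π ⁻¹' {π x}).ncard) ?_
    ⟨d * e, hde, N₁, hN₁.trans hN'N, hxN₁, hN₁m, rfl⟩
  rw [← hs]
  refine ncard_lt_ncard ⟨inter_subset_inter_left _ hN₁, fun h => ?_⟩
    ((hfin _).subset inter_subset_right)
  exact Set.disjoint_left.1 hdisj (h ⟨hN₂ hz, hzx⟩).1 hz

end MinimalSubset

section LiYorke

/-- For a weakly mixing minimal system, the points `z` whose orbit together with that of `x` visits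
all pairs of open sets are dense. -/
theorem MinimalSystem.dense_joint_visits {X : Type*} [TopologicalSpace X] [CompactSpace X]
    [T2Space X] [SecondCountableTopology X] {T : X → X} (hT : MinimalSystem T)
    (hTc : Continuous T) (hmix : BoxMixing T) (x : X) :
    Dense {z | ∀ U V : Set X, IsOpen U → IsOpen V → U.Nonempty → V.Nonempty →
      ∀ m, ∃ n ≥ m, T^[n] x ∈ U ∧ T^[n] z ∈ V} := by
  let b := TopologicalSpace.countableBasis X
  let ι := {U : Set X // U ∈ b ∧ U.Nonempty}
  have : Countable ι :=
    ((TopologicalSpace.countable_countableBasis X).mono fun U hU => hU.1 :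
      {U : Set X | U ∈ b ∧ U.Nonempty}.Countable).to_subtype
  have hopen : ∀ U : ι, IsOpen U.1 := fun U =>
    TopologicalSpace.isOpen_of_mem_countableBasis U.2.1
  let D : ι × ι × ℕ → Set X := fun p => ⋃ n ∈ {n | n ≥ p.2.2 ∧ T^[n] x ∈ p.1.1},
    T^[n] ⁻¹' p.2.1.1
  have hD : Dense (⋂ p, D p) := by
    refine dense_iInter_of_isOpen
      (fun p => isOpen_biUnion fun n _ => (hopen _).preimage (hTc.iterate n)) fun p => ?_
    rw [dense_iff_inter_open]
    intro G hG nG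
    obtain ⟨n, hn, hx, z, hz, hzV⟩ := hT.exists_common_time hTc hmix hTc (hT.surjective hTc)
      (hopen p.1) p.1.2.2 hG (hopen p.2.1) nG p.2.1.2.2 x p.2.2
    exact ⟨z, hz, mem_biUnion (show n ∈ {n | n ≥ p.2.2 ∧ T^[n] x ∈ p.1.1} from ⟨hn, hx⟩) hzV⟩
  refine hD.mono fun z hz U V hU hV nU nV m => ?_
  have hbasis : ∀ G : Set X, IsOpen G → G.Nonempty → ∃ G' : ι, G'.1 ⊆ G := by
    rintro G hG ⟨g, hg⟩
    obtain ⟨G', hG'b, hgG', hG'⟩ :=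
      (TopologicalSpace.isBasis_countableBasis X).exists_subset_of_mem_open hg hG
    exact ⟨⟨G', hG'b, g, hgG'⟩, hG'⟩
  obtain ⟨U', hU'⟩ := hbasis U hU nU
  obtain ⟨V', hV'⟩ := hbasis V hV nV
  obtain ⟨n, ⟨hn, hx⟩, hzn⟩ := mem_iUnion₂.1 (mem_iInter.1 hz (U', V', m))
  exact ⟨n, hn, hU' hx, hV' hzn⟩

theorem LiYorkePairEps.of_frequently {X : Type*} [MetricSpace X] [CompactSpace X] {T : X → X}
    {x y : X} {ε δ : ℝ} (hεδ : ε < δ)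
    (hprox : ∀ η > 0, ∀ m, ∃ n ≥ m, dist (T^[n] x) (T^[n] y) < η)
    (hfar : ∀ m, ∃ n ≥ m, δ < dist (T^[n] x) (T^[n] y)) : LiYorkePairEps T ε x y := by
  have hbelow : IsBoundedUnder (· ≥ ·) atTop fun n : ℕ => dist (T^[n] x) (T^[n] y) :=
    isBoundedUnder_of ⟨0, fun n => dist_nonneg⟩
  have habove : IsBoundedUnder (· ≤ ·) atTop fun n : ℕ => dist (T^[n] x) (T^[n] y) :=
    isBoundedUnder_of ⟨diam (univ : Set X), fun n =>
      dist_le_diam_of_mem isCompact_univ.isBounded (mem_univ _) (mem_univ _)⟩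
  constructor
  · refine le_antisymm (le_of_forall_pos_le_add fun η hη => ?_) ?_
    · rw [zero_add]
      exact liminf_le_of_frequently_le
        ((frequently_atTop.2 (hprox η hη)).mono fun n hn => hn.le) hbelow
    · exact le_liminf_of_le habove.isCoboundedUnder_ge (Eventually.of_forall fun n => dist_nonneg)
  · exact hεδ.trans_le (le_limsup_of_frequently_le
      ((frequently_atTop.2 hfar).mono fun n hn => hn.le) habove)

end LiYorke

/-- If `(Y,S)` is minimal, weakly mixing, not connected, every subcontinuum of `Y` is
unicoherent, and `(X,T)` is an extension of `(Y,S)` all of whose fibres have exactly `n`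
points then, for every minimal set `M ⊆ X` of `T`, the system `(M, T|_M)` is Li-Yorke
sensitive. -/
theorem stmt18 {X Y : Type*} [MetricSpace X] [CompactSpace X]
    [MetricSpace Y] [CompactSpace Y]
    (T : X → X) (hTc : Continuous T) (hTs : Function.Surjective T)
    (S : Y → Y) (hSc : Continuous S) (hSs : Function.Surjective S)
    (π : X → Y) (hπc : Continuous π) (hπs : Function.Surjective π)
    (hfac : ∀ x : X, π (T x) = S (π x))
    (hmin : MinimalSystem S) (hwm : WeaklyMixing S)
    (hconn : ¬ ConnectedSpace Y)
    (huni : ∀ Z : Set Y, IsCompact Z → IsConnected Z → UnicoherentSet Z)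
    (n : ℕ) (hn : 0 < n) (hfib : ∀ y : Y, Set.ncard (π ⁻¹' {y}) = n)
    (M : Set X) (hM : IsMinimalSubset T M) :
    LYS (Set.MapsTo.restrict T M M hM.2.2.1) := by
  have hmix := hwm.boxMixing
  have hfin : ∀ y, (π ⁻¹' {y}).Finite := fun y => finite_of_ncard_pos (by rw [hfib]; exact hn)
  obtain ⟨a, b, hab⟩ : ∃ a b : Y, a ≠ b := by
    by_contra! h
    have : Subsingleton Y := ⟨h⟩
    obtain ⟨x, -⟩ := hM.1
    exact hconn { toNonempty := ⟨π x⟩ }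
  obtain ⟨δ, hδ, hπδ⟩ := Metric.uniformContinuous_iff.1
    (CompactSpace.uniformContinuous_of_continuous hπc) (dist a b / 3)
    (div_pos (dist_pos.2 hab) three_pos)
  refine ⟨δ / 3, by positivity, ?_⟩
  rintro ⟨x, hxM⟩
  obtain ⟨d, hd, N, hNM, hxN, htot⟩ :=
    hM.exists_totally_minimal hTc hmin hSc hmix hπc hfac hfin hxM
  have hN : IsMinimalSubset T^[d] N := htot 1 one_pos
  have hSd := hmin.iterate_of_boxMixing hmix hSc hd
  have himg : π '' N = univ := hN.image_eq_univ hSd hπc (semiconj_iterate hfac d)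
  have : CompactSpace N := isCompact_iff_compactSpace.1 hN.2.1.isCompact
  have : CompactSpace M := isCompact_iff_compactSpace.1 hM.2.1.isCompact
  set R : N → N := hN.2.2.1.restrict T^[d] N N with hR
  have hRc : Continuous R := (hTc.iterate d).restrict hN.2.2.1
  have hRe : ∀ e > 0, MinimalSystem R^[e] := by
    intro e he
    rw [hR, MapsTo.iterate_restrict]
    exact (htot e he).minimalSystem_restrict
  have hφs : Function.Surjective fun z : N => π z := by
    intro y
    obtain ⟨z, hz, rfl⟩ : y ∈ π '' N := himg ▸ mem_univ y
    exact ⟨⟨z, hz⟩, rfl⟩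
  have hφc : Continuous fun z : N => π z := hπc.comp continuous_subtype_val
  have hφimg : ∀ y, Subtype.val '' ((fun z : N => π z) ⁻¹' {y}) ⊆ π ⁻¹' {y} := by
    rintro y _ ⟨z, hz, rfl⟩
    exact hz
  have hRmix : BoxMixing R := boxMixing_of_finite_extension (S := S^[d]) hRe hRc hSd
    (hSc.iterate d) (hmix.iterate hSc hSs hd) hφc hφs
    (fun z => semiconj_iterate hfac d z) n
    (fun y => ((hfin y).subset (hφimg y)).of_finite_image Subtype.val_injective.injOn)
    (fun y => by
      rw [← ncard_image_of_injective _ Subtype.val_injective, ← hfib y]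
      exact ncard_le_ncard (hφimg y) (hfin y))
  have hR1 : MinimalSystem R := hRe 1 one_pos
  rw [Metric.mem_closure_iff]
  intro r hr
  obtain ⟨z, hz, hzr⟩ := (hR1.dense_joint_visits hRc hRmix ⟨x, hxN⟩).exists_mem_open
    (isOpen_ball (x := (⟨x, hxN⟩ : N)) (ε := r)) ⟨_, mem_ball_self hr⟩
  have hdist : ∀ k, dist ((hM.2.2.1.restrict T M M)^[d * k] ⟨x, hxM⟩)
      ((hM.2.2.1.restrict T M M)^[d * k] ⟨z, hNM z.2⟩) = dist (R^[k] ⟨x, hxN⟩) (R^[k] z) := by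
    intro k
    rw [Subtype.dist_eq, Subtype.dist_eq, MapsTo.coe_iterate_restrict,
      MapsTo.coe_iterate_restrict, hR, MapsTo.coe_iterate_restrict, MapsTo.coe_iterate_restrict,
      Function.iterate_mul]
  have htime : ∀ k m : ℕ, m ≤ k → m ≤ d * k := fun k m h =>
    h.trans (Nat.le_mul_of_pos_left k hd)
  refine ⟨⟨z, hNM z.2⟩, LiYorkePairEps.of_frequently (δ := δ / 2) (by linarith) ?_ ?_, ?_⟩
  · intro η hη m
    obtain ⟨k, hk, hkx, hkz⟩ := hz (ball ⟨x, hxN⟩ (η / 2)) (ball ⟨x, hxN⟩ (η / 2)) isOpen_ball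
      isOpen_ball ⟨_, mem_ball_self (half_pos hη)⟩ ⟨_, mem_ball_self (half_pos hη)⟩ m
    refine ⟨d * k, htime k m hk, ?_⟩
    rw [hdist]
    have := dist_triangle_right (R^[k] ⟨x, hxN⟩) (R^[k] z) ⟨x, hxN⟩
    rw [mem_ball] at hkx hkz
    linarith
  · intro m
    have hpos : 0 < dist a b / 3 := div_pos (dist_pos.2 hab) three_pos
    have hne : ∀ c : Y, ((fun z : N => π z) ⁻¹' ball c (dist a b / 3)).Nonempty := fun c =>
      Set.Nonempty.preimage ⟨c, mem_ball_self hpos⟩ hφs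
    obtain ⟨k, hk, hkx, hkz⟩ := hz _ _ (isOpen_ball.preimage hφc) (isOpen_ball.preimage hφc)
      (hne a) (hne b) m
    refine ⟨d * k, htime k m hk, ?_⟩
    rw [hdist]
    by_contra! hle
    have h1 := hπδ (a := (R^[k] ⟨x, hxN⟩ : N)) (b := (R^[k] z : N))
      (by rw [← Subtype.dist_eq]; linarith)
    rw [mem_preimage, mem_ball] at hkx hkz
    have h2 := dist_triangle4 a (π (R^[k] ⟨x, hxN⟩ : N)) (π (R^[k] z : N)) b
    rw [dist_comm a (π _)] at h2
    linarith
  · rw [mem_ball, dist_comm] at hzr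
    exact hzr
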